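/- arXiv:1109.4197 — 5 statements merged into one kernel-verified Lean document; each statement's English description precedes it below -/
import Mathlib

section
/- Let ψ, c₁, c₂, c₃, c₄ be real constants. Define on ℝ⁴ (coordinates (u,w,x,y)) the symmetric matrix-valued function g with nonzero components g₀₀ = H, g₀₁ = g₁₀ = A, g₀₂ = g₂₀ = w + c₂ψe^{ψu}, g₀₃ = g₃₀ = c₃e^{ψu}, g₂₂ = g₃₃ = −1, where A = c₂e^{ψu} − x and H = 2A(c₁(x²+y²)e^{−ψu} + c₄e^{ψu}) − c₃²e^{2ψu} − w² − ψ²x² − 2ψwx. Then the vector field ξ : ℝ⁴ → ℝ⁴ with components ξ = (1, ψw, ψx, ψy) satisfies the homothetic equation (L_ξ g)_{ab} = 2ψ g_{ab} at every point of ℝ⁴, where (L_ξ g)_{ab} = ξ^c ∂_c g_{ab} + g_{cb} ∂_a ξ^c + g_{ac} ∂_b ξ^c. In particular, ξ is a homothetic vector field of the conformally flat pure radiation metric ds² = H du² + 2A du dw + 2(w + c₂ψe^{ψu}) du dx + 2c₃e^{ψu} du dy − dx² − dy² with constant divergence ψ (a Killing vector when ψ = 0). -/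
open Real

/-- Partial derivative ∂ᵢ of a scalar function on ℝ⁴ (coordinates indexed by `Fin 4`). -/
noncomputable def pd (i : Fin 4) (f : (Fin 4 → ℝ) → ℝ) (p : Fin 4 → ℝ) : ℝ :=
  fderiv ℝ f p (Pi.single i 1)

/-- Componentwise Lie derivative of a matrix-valued metric `g` along a vector field `X`:
`(L_X g)_{ab} = X^c ∂_c g_{ab} + g_{cb} ∂_a X^c + g_{ac} ∂_b X^c`. -/
noncomputable def lieDeriv (X : (Fin 4 → ℝ) → (Fin 4 → ℝ))
    (g : (Fin 4 → ℝ) → Matrix (Fin 4) (Fin 4) ℝ)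
    (p : Fin 4 → ℝ) : Matrix (Fin 4) (Fin 4) ℝ :=
  Matrix.of fun a b =>
    (∑ c : Fin 4, X p c * pd c (fun q => g q a b) p)
    + (∑ c : Fin 4, g p c b * pd a (fun q => X q c) p)
    + (∑ c : Fin 4, g p a c * pd b (fun q => X q c) p)

/-- The function A = c₂ e^{ψu} − x. -/
noncomputable def Afun (ψ c₂ : ℝ) (p : Fin 4 → ℝ) : ℝ :=
  c₂ * exp (ψ * p 0) - p 2

/-- H = 2A(c₁(x²+y²)e^{−ψu} + c₄e^{ψu}) − c₃²e^{2ψu} − w² − ψ²x² − 2ψwx. -/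
noncomputable def Hfun (ψ c₁ c₂ c₃ c₄ : ℝ) (p : Fin 4 → ℝ) : ℝ :=
  2 * Afun ψ c₂ p * (c₁ * ((p 2) ^ 2 + (p 3) ^ 2) * exp (-(ψ * p 0)) + c₄ * exp (ψ * p 0))
    - c₃ ^ 2 * exp (2 * ψ * p 0) - (p 1) ^ 2 - ψ ^ 2 * (p 2) ^ 2 - 2 * ψ * p 1 * p 2

/-- The conformally flat pure radiation metric
`ds² = H du² + 2A du dw + 2(w + c₂ψe^{ψu}) du dx + 2c₃e^{ψu} du dy − dx² − dy²`,
coordinates (u,w,x,y) = (p 0, p 1, p 2, p 3). -/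
noncomputable def gMetric (ψ c₁ c₂ c₃ c₄ : ℝ) (p : Fin 4 → ℝ) : Matrix (Fin 4) (Fin 4) ℝ :=
  !![Hfun ψ c₁ c₂ c₃ c₄ p, Afun ψ c₂ p, p 1 + c₂ * ψ * exp (ψ * p 0), c₃ * exp (ψ * p 0);
     Afun ψ c₂ p, 0, 0, 0;
     p 1 + c₂ * ψ * exp (ψ * p 0), 0, -1, 0;
     c₃ * exp (ψ * p 0), 0, 0, -1]

/-- The vector field ξ = (1, ψw, ψx, ψy). -/
noncomputable def xiField (ψ : ℝ) (p : Fin 4 → ℝ) : Fin 4 → ℝ :=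
  ![1, ψ * p 1, ψ * p 2, ψ * p 3]

/-- `f` is differentiable at `p` and an eigenfunction, with eigenvalue `k`, of the derivative in
direction `v` there. -/
def HasWeightAt (v : Fin 4 → ℝ) (k : ℝ) (f : (Fin 4 → ℝ) → ℝ) (p : Fin 4 → ℝ) : Prop :=
  DifferentiableAt ℝ f p ∧ fderiv ℝ f p v = k * f p

namespace HasWeightAt

variable {v p : Fin 4 → ℝ} {k l : ℝ} {f g : (Fin 4 → ℝ) → ℝ}

theorem add (hf : HasWeightAt v k f p) (hg : HasWeightAt v k g p) :
    HasWeightAt v k (fun q => f q + g q) p := by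
  refine ⟨hf.1.add hg.1, ?_⟩
  rw [fderiv_fun_add hf.1 hg.1, add_apply, hf.2, hg.2]
  ring

theorem sub (hf : HasWeightAt v k f p) (hg : HasWeightAt v k g p) :
    HasWeightAt v k (fun q => f q - g q) p := by
  refine ⟨hf.1.sub hg.1, ?_⟩
  rw [fderiv_fun_sub hf.1 hg.1, sub_apply, hf.2, hg.2]
  ring

theorem mul (hf : HasWeightAt v k f p) (hg : HasWeightAt v l g p) :
    HasWeightAt v (k + l) (fun q => f q * g q) p := by
  refine ⟨hf.1.mul hg.1, ?_⟩
  rw [fderiv_fun_mul hf.1 hg.1]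
  simp only [add_apply, smul_apply, smul_eq_mul, hf.2, hg.2]
  ring

theorem const_mul (c : ℝ) (hf : HasWeightAt v k f p) :
    HasWeightAt v k (fun q => c * f q) p := by
  refine ⟨hf.1.const_mul c, ?_⟩
  rw [fderiv_const_mul hf.1]
  simp only [smul_apply, smul_eq_mul, hf.2]
  ring

theorem sq (hf : HasWeightAt v k f p) : HasWeightAt v (2 * k) (fun q => f q ^ 2) p := by
  simpa only [pow_two, two_mul] using hf.mul hf

theorem exp_mul_coord (v p : Fin 4 → ℝ) (i : Fin 4) (c : ℝ) :
    HasWeightAt v (c * v i) (fun q => exp (c * q i)) p := by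
  have h := ((ContinuousLinearMap.proj (R := ℝ) (φ := fun _ : Fin 4 => ℝ) i).hasFDerivAt
    (x := p)).const_mul c |>.exp
  refine ⟨h.differentiableAt, ?_⟩
  erw [h.fderiv]
  simp
  ring

theorem coord {i : Fin 4} (h : v i = k * p i) : HasWeightAt v k (fun q => q i) p :=
  ⟨differentiableAt_apply i p, by
    erw [(ContinuousLinearMap.proj (R := ℝ) (φ := fun _ : Fin 4 => ℝ) i).fderiv]
    exact h⟩

theorem sum_mul_pd (hf : HasWeightAt v k f p) : ∑ c, v c * pd c f p = k * f p := by
  rw [← hf.2]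
  conv_rhs => rw [pi_eq_sum_univ' v, map_sum]
  simp [pd]

end HasWeightAt

theorem pd_xiField (ψ : ℝ) (p : Fin 4 → ℝ) (a c : Fin 4) :
    pd a (fun q => xiField ψ q c) p = if a = c ∧ c ≠ 0 then ψ else 0 := by
  have h (i : Fin 4) : fderiv ℝ (fun q : Fin 4 → ℝ => ψ * q i) p
      = ψ • ContinuousLinearMap.proj i := by
    rw [fderiv_const_mul (differentiableAt_apply i p)]
    exact congrArg (ψ • ·) (ContinuousLinearMap.proj (R := ℝ) (φ := fun _ : Fin 4 => ℝ) i).fderiv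
  fin_cases c <;> fin_cases a <;> simp [pd, xiField, h]

section Weights

variable (ψ c₁ c₂ c₃ c₄ : ℝ) (p : Fin 4 → ℝ)

theorem hasWeightAt_exp (k : ℝ) :
    HasWeightAt (xiField ψ p) k (fun q => exp (k * q 0)) p := by
  simpa [xiField] using HasWeightAt.exp_mul_coord (xiField ψ p) p 0 k

theorem hasWeightAt_coord {i : Fin 4} (hi : i ≠ 0) :
    HasWeightAt (xiField ψ p) ψ (fun q => q i) p := by
  apply HasWeightAt.coord
  fin_cases i <;> simp_all [xiField]

theorem hasWeightAt_Afun : HasWeightAt (xiField ψ p) ψ (Afun ψ c₂) p :=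
  ((hasWeightAt_exp ψ p ψ).const_mul c₂).sub (hasWeightAt_coord ψ p (by decide))

theorem hasWeightAt_Hfun :
    HasWeightAt (xiField ψ p) (2 * ψ) (Hfun ψ c₁ c₂ c₃ c₄) p := by
  have e := hasWeightAt_exp ψ p
  have w := hasWeightAt_coord ψ p (i := 1) (by decide)
  have x := hasWeightAt_coord ψ p (i := 2) (by decide)
  have y := hasWeightAt_coord ψ p (i := 3) (by decide)
  have profile : HasWeightAt (xiField ψ p) ψ
      (fun q => c₁ * (q 2 ^ 2 + q 3 ^ 2) * exp (-(ψ * q 0)) + c₄ * exp (ψ * q 0)) p := by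
    refine HasWeightAt.add ?_ ((e ψ).const_mul c₄)
    convert ((x.sq.add y.sq).const_mul c₁).mul (e (-ψ)) using 1
    · ring
    · simp only [neg_mul]
  have product := ((hasWeightAt_Afun ψ c₂ p).const_mul 2).mul profile
  have cross := (w.const_mul (2 * ψ)).mul x
  rw [← two_mul] at product cross
  exact (((product.sub ((e (2 * ψ)).const_mul (c₃ ^ 2))).sub w.sq).sub
    (x.sq.const_mul (ψ ^ 2))).sub cross

theorem sum_xiField_mul_pd_const (r : ℝ) :
    ∑ c, xiField ψ p c * pd c (fun _ => r) p = 0 := by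
  simp [pd]

end Weights

/-- ξ = (1, ψw, ψx, ψy) is a homothetic vector field of the conformally flat pure
radiation metric, with constant divergence ψ: `L_ξ g = 2ψ g` everywhere. -/
theorem xi_is_homothetic (ψ c₁ c₂ c₃ c₄ : ℝ) (p : Fin 4 → ℝ) :
    lieDeriv (xiField ψ) (gMetric ψ c₁ c₂ c₃ c₄) p
      = (2 * ψ) • gMetric ψ c₁ c₂ c₃ c₄ p := by
  have e := (hasWeightAt_exp ψ p ψ).const_mul
  have hH := (hasWeightAt_Hfun ψ c₁ c₂ c₃ c₄ p).sum_mul_pd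
  have hA := (hasWeightAt_Afun ψ c₂ p).sum_mul_pd
  have hx := ((hasWeightAt_coord ψ p (i := 1) (by decide)).add (e (c₂ * ψ))).sum_mul_pd
  have hy := (e c₃).sum_mul_pd
  have hc := sum_xiField_mul_pd_const ψ p
  ext a b
  simp only [lieDeriv, Matrix.of_apply, pd_xiField]
  fin_cases a <;> fin_cases b <;>
    simp [gMetric, hH, hA, hx, hy, hc, ite_and] <;> ring
end

section
/- Let ψ, c₁, c₂, c₃, c₄ be real constants, and let g be the matrix-valued function on ℝ⁴ (coordinates (u,w,x,y)) with nonzero components g₀₀ = H, g₀₁ = g₁₀ = A, g₀₂ = g₂₀ = w + c₂ψe^{ψu}, g₀₃ = g₃₀ = c₃e^{ψu}, g₂₂ = g₃₃ = −1, where A = c₂e^{ψu} − x and H = 2A(c₁(x²+y²)e^{−ψu} + c₄e^{ψu}) − c₃²e^{2ψu} − w² − ψ²x² − 2ψwx. Then at every point (u,w,x,y) ∈ ℝ⁴ the determinant of g equals −(c₂e^{ψu} − x)². Consequently g is invertible (the metric is nondegenerate) precisely at those points where x ≠ c₂e^{ψu}. -/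
open Real

/-- The determinant of the metric equals −(c₂e^{ψu} − x)², so the metric is nondegenerate
(the matrix is invertible) exactly where x ≠ c₂e^{ψu}. -/
theorem gMetric_det (ψ c₁ c₂ c₃ c₄ : ℝ) (p : Fin 4 → ℝ) :
    (gMetric ψ c₁ c₂ c₃ c₄ p).det = -(c₂ * exp (ψ * p 0) - p 2) ^ 2 ∧
      (IsUnit (gMetric ψ c₁ c₂ c₃ c₄ p) ↔ p 2 ≠ c₂ * exp (ψ * p 0)) := by
  have hdet : (gMetric ψ c₁ c₂ c₃ c₄ p).det = -(c₂ * exp (ψ * p 0) - p 2) ^ 2 := by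
    simp [gMetric, Matrix.det_succ_row_zero, Fin.sum_univ_succ, Fin.succAbove, Afun]
    ring
  refine ⟨hdet, ?_⟩
  rw [Matrix.isUnit_iff_isUnit_det, hdet, isUnit_iff_ne_zero, neg_ne_zero,
    pow_ne_zero_iff two_ne_zero, sub_ne_zero, ne_comm]
end

section
/- Let ψ, c₁, c₂, c₃, c₄ be real constants, and let g be the matrix-valued function on ℝ⁴ (coordinates (u,w,x,y)) with nonzero components g₀₀ = H, g₀₁ = g₁₀ = A, g₀₂ = g₂₀ = w + c₂ψe^{ψu}, g₀₃ = g₃₀ = c₃e^{ψu}, g₂₂ = g₃₃ = −1, where A = c₂e^{ψu} − x and H = 2A(c₁(x²+y²)e^{−ψu} + c₄e^{ψu}) − c₃²e^{2ψu} − w² − ψ²x² − 2ψwx. For each t ∈ ℝ define the diffeomorphism φ_t : ℝ⁴ → ℝ⁴ by φ_t(u,w,x,y) = (u+t, e^{ψt}w, e^{ψt}x, e^{ψt}y), and let J_t denote its (constant) Jacobian matrix diag(1, e^{ψt}, e^{ψt}, e^{ψt}). Then for every t ∈ ℝ and every p ∈ ℝ⁴, the pullback identity J_tᵀ · g(φ_t(p))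 · J_t = e^{2ψt} g(p) holds. That is, the flow of the homothetic vector field (1, ψw, ψx, ψy) rescales the metric by the constant conformal factor e^{2ψt}. -/
open Real Matrix

/-- The flow φ_t(u,w,x,y) = (u+t, e^{ψt}w, e^{ψt}x, e^{ψt}y) of the homothetic
vector field (1, ψw, ψx, ψy). -/
noncomputable def flow (ψ t : ℝ) (p : Fin 4 → ℝ) : Fin 4 → ℝ :=
  ![p 0 + t, exp (ψ * t) * p 1, exp (ψ * t) * p 2, exp (ψ * t) * p 3]

/-- The (constant) Jacobian matrix of φ_t: diag(1, e^{ψt}, e^{ψt}, e^{ψt}). -/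
noncomputable def flowJac (ψ t : ℝ) : Matrix (Fin 4) (Fin 4) ℝ :=
  Matrix.diagonal ![1, exp (ψ * t), exp (ψ * t), exp (ψ * t)]

theorem exp_two_mul_mul (a b : ℝ) : exp (2 * a * b) = exp (a * b) ^ 2 := by
  rw [mul_assoc, two_mul, exp_add, sq]

theorem Afun_flow (ψ c₂ t : ℝ) (p : Fin 4 → ℝ) :
    Afun ψ c₂ (flow ψ t p) = exp (ψ * t) * Afun ψ c₂ p := by
  simp only [Afun, flow, cons_val, mul_add, exp_add]
  ring

theorem Hfun_flow (ψ c₁ c₂ c₃ c₄ t : ℝ) (p : Fin 4 → ℝ) :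
    Hfun ψ c₁ c₂ c₃ c₄ (flow ψ t p) = exp (ψ * t) ^ 2 * Hfun ψ c₁ c₂ c₃ c₄ p := by
  simp only [Hfun, Afun_flow, exp_two_mul_mul]
  simp only [flow, cons_val, mul_add, neg_add, exp_add, exp_neg]
  field_simp

/-- The pullback of the metric by the flow φ_t rescales it by the constant conformal
factor e^{2ψt}: `J_tᵀ · g(φ_t(p)) · J_t = e^{2ψt} g(p)`. -/
theorem flow_is_homothety (ψ c₁ c₂ c₃ c₄ : ℝ) (t : ℝ) (p : Fin 4 → ℝ) :
    (flowJac ψ t)ᵀ * gMetric ψ c₁ c₂ c₃ c₄ (flow ψ t p) * flowJac ψ t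
      = exp (2 * ψ * t) • gMetric ψ c₁ c₂ c₃ c₄ p := by
  rw [exp_two_mul_mul]
  ext i j
  simp only [flowJac, diagonal_transpose, mul_diagonal, diagonal_mul, Matrix.smul_apply,
    smul_eq_mul, gMetric, Hfun_flow, Afun_flow]
  fin_cases i <;> fin_cases j <;> simp [flow, mul_add, exp_add] <;> ring
end

section
/- Let ψ be a nonzero real constant. Define on ℝ⁴ (coordinates (u,w,x,y)) the symmetric matrix-valued function g with nonzero components g₀₀ = −(2x(x²+y²) + w²), g₀₁ = g₁₀ = −x, g₀₂ = g₂₀ = w, g₂₂ = g₃₃ = −1. Then the vector field ξ : ℝ⁴ → ℝ⁴ with components ξ = (−½ψu, (3/2)ψw, ψx, ψy) satisfies the homothetic equation (L_ξ g)_{ab} = 2ψ g_{ab} at every point of ℝ⁴, where (L_ξ g)_{ab} = ξ^c ∂_c g_{ab} + g_{cb} ∂_a ξ^c + g_{ac} ∂_b ξ^c. Thus ξ is a proper homothetic vector field (constant divergence ψ ≠ 0) of the type O pure radiation metric ds² = −(2x(x²+y²)+w²) du² − 2x du dw + 2w du dx − dx² − dy². -/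
open Real

/-- The type O pure radiation metric
`ds² = −(2x(x²+y²)+w²) du² − 2x du dw + 2w du dx − dx² − dy²`,
coordinates (u,w,x,y) = (p 0, p 1, p 2, p 3). -/
noncomputable def gMax (p : Fin 4 → ℝ) : Matrix (Fin 4) (Fin 4) ℝ :=
  !![-(2 * p 2 * ((p 2) ^ 2 + (p 3) ^ 2) + (p 1) ^ 2), -(p 2), p 1, 0;
     -(p 2), 0, 0, 0;
     p 1, 0, -1, 0;
     0, 0, 0, -1]

/-- The vector field ξ = (−½ψu, (3/2)ψw, ψx, ψy). -/
noncomputable def xiMax (ψ : ℝ) (p : Fin 4 → ℝ) : Fin 4 → ℝ :=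
  ![-(1 / 2) * ψ * p 0, (3 / 2) * ψ * p 1, ψ * p 2, ψ * p 3]

section PartialDerivatives

variable (i : Fin 4) {f h : (Fin 4 → ℝ) → ℝ} {p : Fin 4 → ℝ}

lemma pd_const (c : ℝ) : pd i (fun _ => c) p = 0 := by
  simp [pd]

lemma pd_coord (j : Fin 4) : pd i (fun q => q j) p = if j = i then 1 else 0 := by
  have hj : HasFDerivAt (fun q : Fin 4 → ℝ => q j) (ContinuousLinearMap.proj j) p :=
    (ContinuousLinearMap.proj (R := ℝ) (φ := fun _ : Fin 4 => ℝ) j).hasFDerivAt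
  simp [pd, hj.fderiv, Pi.single_apply]

lemma pd_neg : pd i (fun q => -f q) p = -pd i f p := by
  simp [pd, fderiv_fun_neg]

lemma pd_add (hf : DifferentiableAt ℝ f p) (hh : DifferentiableAt ℝ h p) :
    pd i (fun q => f q + h q) p = pd i f p + pd i h p := by
  simp [pd, fderiv_fun_add hf hh]

lemma pd_mul (hf : DifferentiableAt ℝ f p) (hh : DifferentiableAt ℝ h p) :
    pd i (fun q => f q * h q) p = f p * pd i h p + h p * pd i f p := by
  simp [pd, fderiv_fun_mul hf hh]

lemma pd_sq (hf : DifferentiableAt ℝ f p) :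
    pd i (fun q => f q ^ 2) p = 2 * f p * pd i f p := by
  simp only [pow_two, pd_mul i hf hf]
  ring

end PartialDerivatives

lemma pd_gMax_zero_zero (i : Fin 4) (p : Fin 4 → ℝ) :
    pd i (fun q => -(2 * q 2 * ((q 2) ^ 2 + (q 3) ^ 2) + (q 1) ^ 2)) p =
      -((6 * p 2 ^ 2 + 2 * p 3 ^ 2) * (if 2 = i then 1 else 0) +
        4 * p 2 * p 3 * (if 3 = i then 1 else 0) + 2 * p 1 * (if 1 = i then 1 else 0)) := by
  rw [pd_neg, pd_add i (by fun_prop) (by fun_prop), pd_mul i (by fun_prop) (by fun_prop),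
    pd_mul i (by fun_prop) (by fun_prop), pd_add i (by fun_prop) (by fun_prop),
    pd_sq i (by fun_prop), pd_sq i (by fun_prop), pd_sq i (by fun_prop)]
  simp only [pd_coord, pd_const]
  ring

lemma pd_const_mul_coord (i j : Fin 4) (c : ℝ) (p : Fin 4 → ℝ) :
    pd i (fun q => c * q j) p = c * if j = i then 1 else 0 := by
  rw [pd_mul i (by fun_prop) (by fun_prop), pd_coord, pd_const]
  ring

/-- For nonzero ψ, the vector field ξ = (−½ψu, (3/2)ψw, ψx, ψy) is a proper homothetic
vector field of the type O pure radiation metric: L_ξ g = 2ψ g with divergence ψ ≠ 0. -/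
theorem xiMax_is_proper_homothety (ψ : ℝ) (hψ : ψ ≠ 0) (p : Fin 4 → ℝ) :
    lieDeriv (xiMax ψ) gMax p = (2 * ψ) • gMax p := by
  ext a b
  fin_cases a <;> fin_cases b <;>
    simp [lieDeriv, gMax, xiMax, Fin.sum_univ_four, pd_gMax_zero_zero, pd_const_mul_coord,
      pd_neg, pd_coord, pd_const, -neg_add_rev, -mul_eq_mul_left_iff] <;>
    ring
end

section
/- Let ψ be a real constant, and let g be the matrix-valued function on ℝ⁴ (coordinates (u,w,x,y)) with nonzero components g₀₀ = −(2x(x²+y²) + w²), g₀₁ = g₁₀ = −x, g₀₂ = g₂₀ = w, g₂₂ = g₃₃ = −1. For each t ∈ ℝ define the diffeomorphism φ_t : ℝ⁴ → ℝ⁴ by φ_t(u,w,x,y) = (e^{−ψt/2}u, e^{3ψt/2}w, e^{ψt}x, e^{ψt}y), with (constant) Jacobian matrix J_t = diag(e^{−ψt/2}, e^{3ψt/2}, e^{ψt}, e^{ψt}). Then for every t ∈ ℝ and every p ∈ ℝ⁴ the pullback identity J_tᵀ · g(φ_t(p)) · J_t = e^{2ψt} g(p) holds; that is, each φ_t is a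 homothety of the metric ds² = −(2x(x²+y²)+w²) du² − 2x du dw + 2w du dx − dx² − dy² with constant conformal factor e^{2ψt}. -/
open Real Matrix

/-- The map φ_t(u,w,x,y) = (e^{−ψt/2}u, e^{3ψt/2}w, e^{ψt}x, e^{ψt}y). -/
noncomputable def flowMax (ψ t : ℝ) (p : Fin 4 → ℝ) : Fin 4 → ℝ :=
  ![exp (-(ψ * t) / 2) * p 0, exp (3 * ψ * t / 2) * p 1, exp (ψ * t) * p 2,
    exp (ψ * t) * p 3]

/-- The (constant) Jacobian matrix of φ_t: diag(e^{−ψt/2}, e^{3ψt/2}, e^{ψt}, e^{ψt}). -/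
noncomputable def flowMaxJac (ψ t : ℝ) : Matrix (Fin 4) (Fin 4) ℝ :=
  Matrix.diagonal ![exp (-(ψ * t) / 2), exp (3 * ψ * t / 2), exp (ψ * t), exp (ψ * t)]

/-- Each φ_t is a homothety of the type O pure radiation metric with constant
conformal factor e^{2ψt}: `J_tᵀ · g(φ_t(p)) · J_t = e^{2ψt} g(p)`. -/
theorem flowMax_is_homothety (ψ t : ℝ) (p : Fin 4 → ℝ) :
    (flowMaxJac ψ t)ᵀ * gMax (flowMax ψ t p) * flowMaxJac ψ t
      = exp (2 * ψ * t) • gMax p := by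
  have h₁ : exp (-(ψ * t) / 2) = (exp (ψ * t / 2))⁻¹ := by
    rw [← exp_neg]; congr 1; ring
  have h₂ : exp (3 * ψ * t / 2) = exp (ψ * t / 2) ^ 3 := by
    rw [← exp_nat_mul]; congr 1; push_cast; ring
  have h₃ : exp (ψ * t) = exp (ψ * t / 2) ^ 2 := by
    rw [← exp_nat_mul]; congr 1; push_cast; ring
  have h₄ : exp (2 * ψ * t) = exp (ψ * t / 2) ^ 4 := by
    rw [← exp_nat_mul]; congr 1; push_cast; ring
  have hs : exp (ψ * t / 2) ≠ 0 := exp_ne_zero _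
  rw [flowMaxJac, flowMax, h₁, h₂, h₃, h₄]
  generalize exp (ψ * t / 2) = s at hs
  ext i j
  rw [diagonal_transpose, mul_diagonal, diagonal_mul]
  fin_cases i <;> fin_cases j <;> simp [gMax] <;> field_simp
end
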